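/- Let t > 0 and define f : {(x,y) ∈ ℝ² : x ≠ 0} → ℝ⁴ by f(x,y) = ( (1/4)·(8t²y² + cosh(4tx) + 1)·csch(2tx), 0, (1/4)·(8t²y² + cosh(4tx) − 3)·csch(2tx), 2ty·csch(2tx) ). Then: (a) at every point, −f₀² + f₁² + f₂² + f₃² = −1, so f takes values in the two-sheeted hyperboloid in Minkowski space ℝ^{1,3}; and (b) at every point, ∂²f/∂x² + ∂²f/∂y² = 4t²·(coth(2tx)² + csch(2tx)²)·f, so f is a harmonic map into hyperbolic 3-space. -/

import Mathlib

theorem hasDerivAt_sinh_mul (k x : ℝ) :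
    HasDerivAt (fun s => Real.sinh (k * s)) (k * Real.cosh (k * x)) x := by
  simpa [mul_comm] using ((hasDerivAt_id x).const_mul k).sinh

theorem hasDerivAt_cosh_mul (k x : ℝ) :
    HasDerivAt (fun s => Real.cosh (k * s)) (k * Real.sinh (k * x)) x := by
  simpa [mul_comm] using ((hasDerivAt_id x).const_mul k).cosh

theorem iteratedDeriv_two_csch_add_sinh (k A B : ℝ) {x : ℝ} (hk : k ≠ 0) (hx : x ≠ 0) :
    iteratedDeriv 2 (fun s => A * (Real.sinh (k * s))⁻¹ + B * Real.sinh (k * s)) x =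
      k ^ 2 * (A * (Real.cosh (k * x) ^ 2 + 1) / Real.sinh (k * x) ^ 3
        + B * Real.sinh (k * x)) := by
  have hsinh : ∀ {z : ℝ}, z ≠ 0 → Real.sinh (k * z) ≠ 0 := fun hz =>
    Real.sinh_ne_zero.mpr (mul_ne_zero hk hz)
  have hderiv : ∀ z : ℝ, z ≠ 0 →
      HasDerivAt (fun s => A * (Real.sinh (k * s))⁻¹ + B * Real.sinh (k * s))
        (A * (-(k * Real.cosh (k * z)) / Real.sinh (k * z) ^ 2)
          + B * (k * Real.cosh (k * z))) z := fun z hz =>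
    (((hasDerivAt_sinh_mul k z).fun_inv (hsinh hz)).const_mul A).add
      ((hasDerivAt_sinh_mul k z).const_mul B)
  have hev : deriv (fun s => A * (Real.sinh (k * s))⁻¹ + B * Real.sinh (k * s)) =ᶠ[nhds x]
      fun z => A * (-(k * Real.cosh (k * z)) / Real.sinh (k * z) ^ 2)
        + B * (k * Real.cosh (k * z)) := by
    filter_upwards [isOpen_ne.mem_nhds hx] with z hz using (hderiv z hz).deriv
  have hcosh := (hasDerivAt_cosh_mul k x).const_mul k
  have hsecond := ((hcosh.fun_neg.fun_div ((hasDerivAt_sinh_mul k x).fun_pow 2)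
    (pow_ne_zero 2 (hsinh hx))).const_mul A).fun_add (hcosh.const_mul B)
  rw [iteratedDeriv_succ, iteratedDeriv_one, hev.deriv_eq, hsecond.deriv]
  have hs := hsinh hx
  have hc := Real.cosh_sq (k * x)
  field_simp
  simp only [Nat.cast_ofNat, Nat.add_one_sub_one, pow_one]
  grind

theorem iteratedDeriv_two_quadratic (a b c x : ℝ) :
    iteratedDeriv 2 (fun s => a * s ^ 2 + b * s + c) x = 2 * a := by
  have hderiv : deriv (fun s : ℝ => a * s ^ 2 + b * s + c) = fun s => 2 * a * s + b := by
    funext z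
    have h := ((((hasDerivAt_id z).fun_pow 2).const_mul a).fun_add
      ((hasDerivAt_id z).const_mul b)).add_const c
    refine h.deriv.trans ?_
    simp
    ring
  rw [iteratedDeriv_succ, iteratedDeriv_one, hderiv]
  have h := ((hasDerivAt_id x).const_mul (2 * a)).add_const b
  exact h.deriv.trans (mul_one _)

theorem cosh_four_mul (t x : ℝ) :
    Real.cosh (4 * t * x) = 1 + 2 * Real.sinh (2 * t * x) ^ 2 := by
  rw [show 4 * t * x = 2 * (2 * t * x) by ring, Real.cosh_two_mul, Real.cosh_sq]
  ring

/-- The separated function `(α y² + β y + γ) csch (k x) + δ sinh (k x)` is an eigenfunction of the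
Laplacian with potential `k² (coth² + csch²)` as soon as `α = k² δ`. -/
theorem laplacian_csch_quadratic_add_sinh {k : ℝ} (hk : k ≠ 0) {α β γ δ : ℝ}
    (hα : α = k ^ 2 * δ) {g : ℝ → ℝ → ℝ}
    (hg : ∀ x y, x ≠ 0 → g x y =
      (α * y ^ 2 + β * y + γ) * (Real.sinh (k * x))⁻¹ + δ * Real.sinh (k * x))
    {x : ℝ} (y : ℝ) (hx : x ≠ 0) :
    iteratedDeriv 2 (fun s => g s y) x + iteratedDeriv 2 (fun s => g x s) y =
      k ^ 2 * ((Real.cosh (k * x) / Real.sinh (k * x)) ^ 2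
        + ((Real.sinh (k * x))⁻¹) ^ 2) * g x y := by
  have hevx : (fun s => g s y) =ᶠ[nhds x] fun s =>
      (α * y ^ 2 + β * y + γ) * (Real.sinh (k * s))⁻¹ + δ * Real.sinh (k * s) := by
    filter_upwards [isOpen_ne.mem_nhds hx] with z hz using hg z y hz
  have hy : (fun s => g x s) = fun s =>
      (α * (Real.sinh (k * x))⁻¹) * s ^ 2 + (β * (Real.sinh (k * x))⁻¹) * s
        + (γ * (Real.sinh (k * x))⁻¹ + δ * Real.sinh (k * x)) := by
    funext s
    rw [hg x s hx]
    ring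
  rw [hevx.iteratedDeriv_eq, iteratedDeriv_two_csch_add_sinh _ _ _ hk hx, hy,
    iteratedDeriv_two_quadratic, hg x y hx, hα, Real.cosh_sq, div_pow, Real.cosh_sq]
  have hs : Real.sinh (k * x) ≠ 0 := Real.sinh_ne_zero.mpr (mul_ne_zero hk hx)
  field_simp
  ring

/-- The model harmonic map: `f` defined by the given explicit formula on `{x ≠ 0}`
takes values in the two-sheeted hyperboloid `⟨f,f⟩ = -1` in Minkowski space `ℝ^{1,3}`,
and satisfies `∂ₓ²f + ∂_y²f = 4t²(coth(2tx)² + csch(2tx)²) f`, i.e. it is a harmonic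
map into hyperbolic 3-space. -/
theorem model_harmonic_map
    (t : ℝ) (ht : 0 < t)
    (f : ℝ → ℝ → Fin 4 → ℝ)
    (hf : ∀ x y : ℝ, f x y =
      ![ (1/4) * (8 * t^2 * y^2 + Real.cosh (4*t*x) + 1) * (Real.sinh (2*t*x))⁻¹,
         0,
         (1/4) * (8 * t^2 * y^2 + Real.cosh (4*t*x) - 3) * (Real.sinh (2*t*x))⁻¹,
         2 * t * y * (Real.sinh (2*t*x))⁻¹ ]) :
    (∀ x y : ℝ, x ≠ 0 →
      -(f x y 0) ^ 2 + (f x y 1) ^ 2 + (f x y 2) ^ 2 + (f x y 3) ^ 2 = -1) ∧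
    (∀ x y : ℝ, x ≠ 0 → ∀ i : Fin 4,
      iteratedDeriv 2 (fun s => f s y i) x + iteratedDeriv 2 (fun s => f x s i) y
        = 4 * t^2 * ((Real.cosh (2*t*x) / Real.sinh (2*t*x)) ^ 2
            + ((Real.sinh (2*t*x))⁻¹) ^ 2) * f x y i) := by
  have hk : 2 * t ≠ 0 := by positivity
  have hsinh : ∀ {x : ℝ}, x ≠ 0 → Real.sinh (2 * t * x) ≠ 0 := fun hx =>
    Real.sinh_ne_zero.mpr (mul_ne_zero hk hx)
  constructor
  · intro x y hx
    have hs := hsinh hx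
    simp only [hf, cosh_four_mul, Matrix.cons_val]
    field_simp
    ring
  · intro x y hx i
    have hform : ∃ α β γ δ : ℝ, α = (2 * t) ^ 2 * δ ∧ ∀ x y : ℝ, x ≠ 0 → f x y i =
        (α * y ^ 2 + β * y + γ) * (Real.sinh (2 * t * x))⁻¹ + δ * Real.sinh (2 * t * x) := by
      fin_cases i
      · refine ⟨2 * t ^ 2, 0, 1 / 2, 1 / 2, by ring, fun x y hx => ?_⟩
        have hs := hsinh hx
        simp only [hf, cosh_four_mul, Fin.zero_eta, Matrix.cons_val]
        field_simp
        ring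
      · exact ⟨0, 0, 0, 0, by ring, fun x y _ => by simp [hf]⟩
      · refine ⟨2 * t ^ 2, 0, -1 / 2, 1 / 2, by ring, fun x y hx => ?_⟩
        have hs := hsinh hx
        simp only [hf, cosh_four_mul, Fin.reduceFinMk, Matrix.cons_val]
        field_simp
        ring
      · exact ⟨0, 2 * t, 0, 0, by ring, fun x y _ => by simp [hf]⟩
    obtain ⟨α, β, γ, δ, hα, hg⟩ := hform
    rw [show 4 * t ^ 2 = (2 * t) ^ 2 by ring]
    exact laplacian_csch_quadratic_add_sinh (g := fun x y => f x y i) hk hα hg y hx
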